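/- arXiv:math/9808082 — 2 statements merged into one kernel-verified Lean document; each statement's English description precedes it below -/
import Mathlib

section
/- Let O_n be the poset with underlying set Fin n × Bool and order (i,ε) ≤ (j,δ) iff (i,ε) = (j,δ) or i < j (this is the poset M_n(2) of the free n-fold monoidal category on two generators, i.e., the (n−1)-dimensional octahedron). Then the geometric realization of the nerve of O_n is homeomorphic to the unit sphere S^{n−1}, i.e., to Metric.sphere 0 1 in EuclideanSpace ℝ (Fin n). -/
open CategoryTheory

/-- The underlying set of the poset `M_n(2)`: pairs `(i, ε)` with `i : Fin n`,
`ε : Bool` (the `(n−1)`-dimensional octahedron). -/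
structure Octa (n : ℕ) where
  idx : Fin n
  sign : Bool

instance (n : ℕ) : PartialOrder (Octa n) where
  le p q := p = q ∨ p.idx < q.idx
  le_refl p := Or.inl rfl
  le_trans p q r := by
    rintro (rfl | h) (rfl | h')
    · exact Or.inl rfl
    · exact Or.inr h'
    · exact Or.inr h
    · exact Or.inr (h.trans h')
  le_antisymm p q := by
    rintro (rfl | h) (h' | h'')
    · rfl
    · rfl
    · exact h'.symm
    · exact absurd (h.trans h'') (lt_irrefl _)

open Opposite Simplicial

lemma stdSimplex.sum_map_smul {X Y E : Type*} [Fintype X] [Fintype Y] [AddCommGroup E]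
    [Module ℝ E] (f : X → Y) (t : stdSimplex ℝ X) (e : Y → E) :
    ∑ y, stdSimplex.map f t y • e y = ∑ x, t x • e (f x) := by
  classical
  simp only [stdSimplex.map_coe, FunOnFinite.linearMap_apply_apply, Finset.sum_smul]
  rw [← Finset.sum_fiberwise Finset.univ f]
  refine Finset.sum_congr rfl fun y _ => Finset.sum_congr rfl fun x hx => ?_
  rw [(Finset.mem_filter.1 hx).2]

lemma stdSimplex.map_eq_self {X : Type*} [Fintype X] (f : X → X) (t : stdSimplex ℝ X)
    (h : ∀ i, t i ≠ 0 → f i = i) : stdSimplex.map f t = t := by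
  classical
  ext j
  rw [stdSimplex.map_coe, FunOnFinite.linearMap_apply_apply, Finset.sum_filter,
    Finset.sum_eq_single j]
  · by_cases hj : t j = 0
    · simp [hj]
    · simp [h j hj]
  · intro i _ hij
    by_cases hi : t i = 0
    · simp [hi]
    · simp [h i hi, hij]
  · simp

namespace SSet

/-- The characteristic map of a simplex `s` of a simplicial set, as a continuous map from the
topological standard simplex to the geometric realization. -/
noncomputable def charMap {S : SSet.{0}} {k : SimplexCategory} (s : S.obj (op k)) :
    C(_root_.stdSimplex ℝ (Fin (k.len + 1)), toTop.obj S) :=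
  (toTop.obj S).toSSetObjEquiv (op k) ((sSetTopAdj.unit.app S).app (op k) s)

lemma charMap_map {S : SSet.{0}} {k l : SimplexCategory} (f : k ⟶ l) (s : S.obj (op l))
    (t : _root_.stdSimplex ℝ (Fin (k.len + 1))) :
    charMap (S.map f.op s) t = charMap s (_root_.stdSimplex.map f t) := by
  have h := ConcreteCategory.congr_hom ((sSetTopAdj.unit.app S).naturality f.op) s
  exact congrArg (fun z => (toTop.obj S).toSSetObjEquiv (op k) z t) h

lemma homEquiv_app_charMap {S : SSet.{0}} {X : TopCat.{0}} (φ : toTop.obj S ⟶ X)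
    {k : SimplexCategory} (s : S.obj (op k)) (t : _root_.stdSimplex ℝ (Fin (k.len + 1))) :
    X.toSSetObjEquiv (op k) ((sSetTopAdj.homEquiv S X φ).app (op k) s) t = φ (charMap s t) := by
  rw [Adjunction.homEquiv_unit]
  rfl

lemma hom_ext_charMap {S : SSet.{0}} {X : TopCat.{0}} {φ ψ : toTop.obj S ⟶ X}
    (h : ∀ (k : SimplexCategory) (s : S.obj (op k)) (t : _root_.stdSimplex ℝ (Fin (k.len + 1))),
      φ (charMap s t) = ψ (charMap s t)) : φ = ψ := by
  apply (sSetTopAdj.homEquiv S X).injective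
  ext k s
  apply (X.toSSetObjEquiv k).injective
  ext t
  exact (homEquiv_app_charMap φ s t).trans ((h _ s t).trans (homEquiv_app_charMap ψ s t).symm)

lemma exists_charMap_eq {S : SSet.{0}} (x : toTop.obj S) :
    ∃ (k : SimplexCategory) (s : S.obj (op k)) (t : _root_.stdSimplex ℝ (Fin (k.len + 1))),
      charMap s t = x := by
  let Y : TopCat.{0} := @TopCat.of Prop ⊤
  let φ : toTop.obj S ⟶ Y :=
    @TopCat.ofHom _ _ _ ⊤ (@ContinuousMap.mk _ _ _ ⊤ (fun x => ∃ (k : SimplexCategory)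
      (s : S.obj (op k)) (t : _root_.stdSimplex ℝ (Fin (k.len + 1))), charMap s t = x)
      continuous_top)
  let ψ : toTop.obj S ⟶ Y :=
    @TopCat.ofHom _ _ _ ⊤ (@ContinuousMap.mk _ _ _ ⊤ (fun _ => True) continuous_top)
  have h : φ = ψ := hom_ext_charMap fun k s t => eq_true ⟨k, s, t, rfl⟩
  exact of_eq_true (ConcreteCategory.congr_hom h x)

/-- The map from the realization of the nerve of a preorder to a real topological vector space
which extends a given map on vertices affinely. -/
lemma exists_affine_extension {P : Type} [Preorder P] {E : Type} [AddCommGroup E] [Module ℝ E]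
    [TopologicalSpace E] [ContinuousAdd E] [ContinuousSMul ℝ E] (e : P → E) :
    ∃ φ : C(toTop.obj (nerve P), E), ∀ (k : SimplexCategory) (s : (nerve P).obj (op k))
      (t : _root_.stdSimplex ℝ (Fin (k.len + 1))), φ (charMap s t) = ∑ j, t j • e (s.obj j) := by
  let g : nerve P ⟶ TopCat.toSSet.obj (TopCat.of E) :=
    { app := fun k => TypeCat.ofHom fun s => ((TopCat.of E).toSSetObjEquiv k).symm
        ⟨fun t => ∑ j, t.1 j • e (s.obj j), by
          refine continuous_finsetSum _ fun j _ => Continuous.smul ?_ continuous_const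
          exact (continuous_apply j).comp continuous_subtype_val⟩
      naturality := by
        intro k l f
        ext s
        apply ((TopCat.of E).toSSetObjEquiv l).injective
        ext t
        exact (stdSimplex.sum_map_smul f.unop t fun j => e (s.obj j)).symm }
  refine ⟨((sSetTopAdj.homEquiv _ _).symm g).hom, fun k s t => ?_⟩
  refine (homEquiv_app_charMap ((sSetTopAdj.homEquiv _ _).symm g) s t).symm.trans ?_
  rw [Equiv.apply_symm_apply]
  rfl

end SSet

/-- Every nonempty finite set in a linear order admits a monotone retraction onto it. -/
lemma Finset.exists_monotone_retraction {α : Type*} [LinearOrder α] (A : Finset α)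
    (hA : A.Nonempty) : ∃ f : α →o α, (∀ i, f i ∈ A) ∧ ∀ i ∈ A, f i = i := by
  refine ⟨⟨fun i => (insert (A.min' hA) (A.filter (· ≤ i))).max' (by simp), ?_⟩, ?_, ?_⟩
  · intro i j hij
    apply Finset.max'_subset
    apply Finset.insert_subset_insert
    intro x hx
    simp only [Finset.mem_filter] at hx ⊢
    exact ⟨hx.1, hx.2.trans hij⟩
  · intro i
    have h := Finset.max'_mem (insert (A.min' hA) (A.filter (· ≤ i))) (by simp)
    rcases Finset.mem_insert.1 h with h | h
    · exact Eq.subst (motive := (· ∈ A)) h.symm (A.min'_mem hA)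
    · exact (Finset.mem_filter.1 h).1
  · intro i hi
    apply le_antisymm
    · refine Finset.max'_le _ (by simp) _ fun y hy => ?_
      rcases Finset.mem_insert.1 hy with rfl | h
      · exact A.min'_le i hi
      · exact (Finset.mem_filter.1 h).2
    · exact Finset.le_max' (insert (A.min' hA) (A.filter (· ≤ i))) i
        (Finset.mem_insert_of_mem (by simp [hi]))

namespace Octa

/-- The sign of a Boolean, as a real number. -/
def signValue (b : Bool) : ℝ := if b then 1 else -1

lemma abs_signValue (b : Bool) : |signValue b| = 1 := by
  cases b <;> simp [signValue]

lemma signValue_injective : Function.Injective signValue := by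
  intro a b
  cases a <;> cases b <;> norm_num [signValue]

lemma signValue_decide_mul_abs (x : ℝ) : signValue (decide (0 ≤ x)) * |x| = x := by
  by_cases h : 0 ≤ x
  · simp [signValue, h, abs_of_nonneg]
  · simp [signValue, h, abs_of_neg (not_le.1 h)]

/-- The maximal chain of the octahedral poset with prescribed signs. -/
def facet {m : ℕ} (ε : Fin (m + 1) → Bool) : (nerve (Octa (m + 1))) _⦋m⦌ :=
  Monotone.functor (f := fun i => (⟨i, ε i⟩ : Octa (m + 1))) fun i j h => by
    rcases h.eq_or_lt with rfl | h
    · exact Or.inl rfl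
    · exact Or.inr h

lemma exists_facet {m : ℕ} {k : SimplexCategory} (s : (nerve (Octa (m + 1))).obj (op k)) :
    ∃ (ε : Fin (m + 1) → Bool) (f : k ⟶ ⦋m⦌),
      s = (nerve (Octa (m + 1))).map f.op (facet ε) := by
  classical
  have hs : Monotone fun j => s.obj j := fun i j h => leOfHom (s.map (homOfLE h))
  have hle {p q : Octa (m + 1)} (h : p ≤ q) : p.idx ≤ q.idx := by
    rcases h with rfl | h
    · exact le_rfl
    · exact h.le
  have heq {p q : Octa (m + 1)} (h : p ≤ q) (h' : p.idx = q.idx) : p = q :=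
    h.resolve_right h'.not_lt
  refine ⟨fun i => if h : ∃ j, (s.obj j).idx = i then (s.obj h.choose).sign else true,
    SimplexCategory.mkHom ⟨fun j => (s.obj j).idx, fun i j h => hle (hs h)⟩, ?_⟩
  refine nerve.ext_of_isThin (funext fun j => ?_)
  have hj : ∃ l, (s.obj l).idx = (s.obj j).idx := ⟨j, rfl⟩
  have hsign : s.obj hj.choose = s.obj j := by
    rcases le_total hj.choose j with h | h
    · exact heq (hs h) hj.choose_spec
    · exact (heq (hs h) hj.choose_spec.symm).symm
  refine congrArg (Octa.mk (s.obj j).idx) (Eq.symm ((dif_pos hj).trans ?_))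
  exact congrArg Octa.sign hsign

lemma facet_map_congr {m : ℕ} {ε δ : Fin (m + 1) → Bool} {k : SimplexCategory} (f : k ⟶ ⦋m⦌)
    (h : ∀ i, ε (f i) = δ (f i)) : (nerve (Octa (m + 1))).map f.op (facet ε) =
      (nerve (Octa (m + 1))).map f.op (facet δ) := by
  refine nerve.ext_of_isThin (funext fun j => ?_)
  exact congrArg (Octa.mk (f j)) (h j)

lemma charMap_facet_congr {m : ℕ} {ε δ : Fin (m + 1) → Bool} (t : stdSimplex ℝ (Fin (m + 1)))
    (h : ∀ i, t i ≠ 0 → ε i = δ i) :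
    SSet.charMap (k := ⦋m⦌) (facet ε) t = SSet.charMap (k := ⦋m⦌) (facet δ) t := by
  classical
  have hne : (Finset.univ.filter fun i => t i ≠ 0).Nonempty := by
    obtain ⟨i, -, hi⟩ := Finset.exists_ne_zero_of_sum_ne_zero
      (show ∑ i, t i ≠ 0 by simp)
    exact ⟨i, by simpa using hi⟩
  obtain ⟨f, hf, hf'⟩ := Finset.exists_monotone_retraction _ hne
  let F : (⦋m⦌ : SimplexCategory) ⟶ ⦋m⦌ := SimplexCategory.mkHom f
  have ht : stdSimplex.map F t = t :=
    stdSimplex.map_eq_self _ t fun i hi => hf' i (by simpa using hi)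
  have hF := facet_map_congr (ε := ε) (δ := δ) F fun i =>
    h (f i) (by simpa using hf i)
  rw [← ht, ← SSet.charMap_map F (facet ε), ← SSet.charMap_map F (facet δ), hF]

lemma exists_charMap_facet {m : ℕ} (x : SSet.toTop.obj (nerve (Octa (m + 1)))) :
    ∃ (ε : Fin (m + 1) → Bool) (t : stdSimplex ℝ (Fin (m + 1))),
      SSet.charMap (k := ⦋m⦌) (facet ε) t = x := by
  obtain ⟨k, s, t, rfl⟩ := SSet.exists_charMap_eq x
  obtain ⟨ε, f, rfl⟩ := exists_facet s
  exact ⟨ε, stdSimplex.map f t, (SSet.charMap_map f (facet ε) t).symm⟩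

instance {m : ℕ} : CompactSpace (SSet.toTop.obj (nerve (Octa (m + 1)))) := by
  refine ⟨?_⟩
  have : (Set.univ : Set (SSet.toTop.obj (nerve (Octa (m + 1))))) =
      ⋃ ε : Fin (m + 1) → Bool, Set.range (SSet.charMap (k := ⦋m⦌) (facet ε)) := by
    ext x
    simpa using exists_charMap_facet x
  rw [this]
  exact isCompact_iUnion fun ε => isCompact_range (ContinuousMap.continuous _)

/-- The realization maps to Euclidean space, each facet being sent affinely to the corresponding
facet of the cross-polytope. -/
lemma exists_crossPolytope_map (m : ℕ) :
    ∃ φ : C(SSet.toTop.obj (nerve (Octa (m + 1))), EuclideanSpace ℝ (Fin (m + 1))),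
      ∀ (ε : Fin (m + 1) → Bool) (t : stdSimplex ℝ (Fin (m + 1))) (i : Fin (m + 1)),
        φ (SSet.charMap (k := ⦋m⦌) (facet ε) t) i = signValue (ε i) * t i := by
  obtain ⟨φ, hφ⟩ := SSet.exists_affine_extension fun p : Octa (m + 1) =>
    EuclideanSpace.single p.idx (signValue p.sign)
  refine ⟨φ, fun ε t i => ?_⟩
  rw [hφ ⦋m⦌ (facet ε) t]
  change (∑ j : Fin (m + 1), t j • EuclideanSpace.single j (signValue (ε j))) i = _
  simp [Pi.single_apply, mul_comm]

end Octa

/-- the geometric realization of the nerve of the octahedral poset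
`M_n(2)` is homeomorphic to the sphere `S^{n−1}`. -/
theorem octahedron_nerve_homeo_sphere (n : ℕ) (hn : 1 ≤ n) :
    Nonempty ((SSet.toTop.obj (nerve (Octa n))) ≃ₜ
      (Metric.sphere (0 : EuclideanSpace ℝ (Fin n)) 1)) := by
  obtain ⟨m, rfl⟩ : ∃ m, n = m + 1 := ⟨n - 1, by omega⟩
  obtain ⟨φ, hφ⟩ := Octa.exists_crossPolytope_map m
  have hφ0 (x) : φ x ≠ 0 := by
    obtain ⟨ε, t, rfl⟩ := Octa.exists_charMap_facet x
    intro h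
    have ht (i) : t i = 0 := by
      simpa [h, Octa.abs_signValue] using congrArg abs (hφ ε t i).symm
    simpa [ht] using stdSimplex.sum_eq_one t
  let ψ (x : SSet.toTop.obj (nerve (Octa (m + 1)))) :
      Metric.sphere (0 : EuclideanSpace ℝ (Fin (m + 1))) 1 :=
    ⟨‖φ x‖⁻¹ • φ x, by simp [norm_smul, hφ0 x]⟩
  have hψ : Continuous ψ :=
    ((φ.continuous.norm.inv₀ fun x => norm_ne_zero_iff.2 (hφ0 x)).smul φ.continuous).subtype_mk _
  refine ⟨hψ.homeoOfEquivCompactToT2 (f := Equiv.ofBijective ψ ⟨?_, ?_⟩)⟩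
  · intro x y hxy
    have hφxy : φ x = φ y := by
      obtain ⟨c, hc, hcxy⟩ : ∃ c : ℝ, 0 < c ∧ φ x = c • φ y := by
        refine ⟨‖φ x‖ * ‖φ y‖⁻¹, by have := hφ0 x; have := hφ0 y; positivity, ?_⟩
        have h : ‖φ x‖⁻¹ • φ x = ‖φ y‖⁻¹ • φ y := congrArg Subtype.val hxy
        rw [mul_smul, ← h, smul_inv_smul₀ (norm_ne_zero_iff.2 (hφ0 x))]
      have hc1 : ∑ i, |φ x i| = c * ∑ i, |φ y i| := by
        simp [hcxy, abs_mul, abs_of_pos hc, Finset.mul_sum]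
      have hsum (z) : ∑ i, |φ z i| = 1 := by
        obtain ⟨ε, t, rfl⟩ := Octa.exists_charMap_facet z
        simp [hφ, abs_mul, Octa.abs_signValue, abs_of_nonneg]
      rw [hsum, hsum, mul_one] at hc1
      rw [hcxy, ← hc1, one_smul]
    obtain ⟨ε, t, rfl⟩ := Octa.exists_charMap_facet x
    obtain ⟨δ, u, rfl⟩ := Octa.exists_charMap_facet y
    have h (i) : Octa.signValue (ε i) * t i = Octa.signValue (δ i) * u i := by
      rw [← hφ, ← hφ, hφxy]
    obtain rfl : t = u := by
      ext i
      simpa [abs_mul, Octa.abs_signValue, abs_of_nonneg] using congrArg abs (h i)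
    exact Octa.charMap_facet_congr t fun i hi =>
      Octa.signValue_injective (mul_right_cancel₀ hi (h i))
  · intro v
    have hv : v.1 ≠ 0 := ne_zero_of_mem_unit_sphere v
    have hpos : 0 < ∑ i, |v.1 i| := by
      refine (Finset.sum_nonneg fun i _ => abs_nonneg _).lt_of_ne' fun h => hv ?_
      ext i
      simpa using (Finset.sum_eq_zero_iff_of_nonneg fun i _ => abs_nonneg _).1 h i
        (Finset.mem_univ i)
    let t : stdSimplex ℝ (Fin (m + 1)) := ⟨fun i => (∑ i, |v.1 i|)⁻¹ * |v.1 i|,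
      fun i => by positivity, by rw [← Finset.mul_sum, inv_mul_cancel₀ hpos.ne']⟩
    refine ⟨SSet.charMap (k := ⦋m⦌) (Octa.facet fun i => decide (0 ≤ v.1 i)) t, ?_⟩
    have h : φ (SSet.charMap (k := ⦋m⦌) (Octa.facet fun i => decide (0 ≤ v.1 i)) t) =
        (∑ i, |v.1 i|)⁻¹ • v.1 := by
      ext i
      rw [hφ]
      change _ * ((∑ i, |v.1 i|)⁻¹ * |v.1 i|) = (∑ i, |v.1 i|)⁻¹ * v.1 i
      rw [mul_left_comm, Octa.signValue_decide_mul_abs]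
    have hnorm : ‖v.1‖ = 1 := norm_eq_of_mem_sphere v
    ext1
    change ‖φ _‖⁻¹ • φ _ = v.1
    rw [h, norm_smul, hnorm, mul_one, Real.norm_of_nonneg (by positivity), inv_inv,
      smul_inv_smul₀ hpos.ne']
end

section
/- Let L_n(k) be the poset of realizable level functions: functions d from {(a,b) : a < b in Fin k} to {1,…,n} for which there exist maps b₁,…,b_{n−1} : Fin k → ℕ such that for all a < b, d(a,b) = min{ j : b_j a ≠ b_j b } (with the convention d(a,b) = n if b_j a = b_j b for all j), and for the minimal such j (when it exists) b_j a < b_j b; the order on L_n(k) is pointwise: d ≤ d′ iff d(a,b) ≤ d′(a,b) for all a < b. (L_n(k) is the poset S(1□ₙ2□ₙ⋯□ₙk) underlying the Milgram preoperad.) Then the geometric realization of the nerve of L_n(k) is homeomorphic to a closed disk of dimension (n−1)(k−1), i.e., to the closed unit ball in EuclideanSpace ℝ (Fin ((n−1)(k−1))). -/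
open CategoryTheory

/-- `Realizes n g d`: the level function `d` is realized by the maps
`g 1, …, g (n−1) : Fin k → ℕ`; for `a < b`, `d a b` is the least `j ∈ {1,…,n−1}` with
`g j a ≠ g j b` (and then `g j a < g j b`), with the convention `d a b = n` when
`g j a = g j b` for all such `j`. -/
def Realizes (n k : ℕ) (g : ℕ → Fin k → ℕ) (d : Fin k → Fin k → ℕ) : Prop :=
  ∀ a b : Fin k, a < b →
    ((∀ j, 1 ≤ j → j < n → g j a = g j b) → d a b = n) ∧
    (∀ j, 1 ≤ j → j < n → g j a ≠ g j b → (∀ j', 1 ≤ j' → j' < j → g j' a = g j' b) →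
      d a b = j ∧ g j a < g j b)

/-- The elements of the poset `L_n(k)`: realizable level functions on the pairs
`a < b` in `Fin k`, with values in `{1,…,n}` (normalized to `0` on non-pairs). -/
structure LFun (n k : ℕ) where
  d : Fin k → Fin k → ℕ
  zero : ∀ a b : Fin k, ¬ a < b → d a b = 0
  bounds : ∀ a b : Fin k, a < b → 1 ≤ d a b ∧ d a b ≤ n
  realizable : ∃ g : ℕ → Fin k → ℕ, Realizes n k g d

instance (n k : ℕ) : PartialOrder (LFun n k) where
  le x y := ∀ a b : Fin k, x.d a b ≤ y.d a b
  le_refl _ _ _ := le_rfl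
  le_trans _ _ _ h h' a b := (h a b).trans (h' a b)
  le_antisymm x y h h' := by
    have hd : x.d = y.d := funext fun a => funext fun b => le_antisymm (h a b) (h' a b)
    cases x; cases y; cases hd; rfl

open Simplicial Opposite

namespace SSet

/-- The point of the geometric realization of `X` with barycentric coordinates `t`
in the simplex `x`. -/
noncomputable def realizationPoint {X : SSet.{0}} {p : SimplexCategory} (x : X.obj (op p))
    (t : _root_.stdSimplex ℝ (Fin (p.len + 1))) : SSet.toTop.obj X :=
  SSet.toTop.map (yonedaEquiv.symm x) (p.toTopHomeo.symm t)

lemma continuous_realizationPoint {X : SSet.{0}} {p : SimplexCategory} (x : X.obj (op p)) :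
    Continuous (realizationPoint x) :=
  (SSet.toTop.map (yonedaEquiv.symm x)).hom.continuous.comp p.toTopHomeo.symm.continuous

lemma realizationPoint_map {X : SSet.{0}} {p q : SimplexCategory} (f : q ⟶ p)
    (x : X.obj (op p)) (t : _root_.stdSimplex ℝ (Fin (q.len + 1))) :
    realizationPoint (X.map f.op x) t = realizationPoint x (stdSimplex.map f t) := by
  have h : (yonedaEquiv.symm (X.map f.op x) : stdSimplex.obj q ⟶ X) =
      SSet.stdSimplex.map f ≫ yonedaEquiv.symm x := by
    ext m α
    exact (Functor.map_comp_apply X f.op (stdSimplex.objEquiv α).op x).symm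
  unfold realizationPoint
  rw [h, Functor.map_comp, SimplexCategory.toTopHomeo_symm_naturality_apply]
  rfl

lemma exists_realizationPoint_eq {X : SSet.{0}} (z : SSet.toTop.obj X) :
    ∃ (p : SimplexCategory) (x : X.obj (op p)) (t : _root_.stdSimplex ℝ (Fin (p.len + 1))),
      realizationPoint x t = z := by
  have h := Limits.isColimitOfPreserves (SSet.toTop ⋙ forget TopCat)
    (Presheaf.colimitOfRepresentable.{0} X)
  obtain ⟨j, y, hy⟩ := Limits.Types.jointly_surjective_of_isColimit h z
  refine ⟨_, j.unop.2, SimplexCategory.toTopHomeo _ y, ?_⟩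
  exact (congrArg (SSet.toTop.map (yonedaEquiv.symm j.unop.2))
    (Homeomorph.symm_apply_apply _ _)).trans hy

lemma exists_realization_lift {X : SSet.{0}} {Y : Type} [TopologicalSpace Y]
    (φ : ∀ p : SimplexCategory, X.obj (op p) → C(_root_.stdSimplex ℝ (Fin (p.len + 1)), Y))
    (hφ : ∀ (p q : SimplexCategory) (f : q ⟶ p) (x : X.obj (op p)) t,
      φ q (X.map f.op x) t = φ p x (stdSimplex.map f t)) :
    ∃ F : C(SSet.toTop.obj X, Y), ∀ (p : SimplexCategory) (x : X.obj (op p)) t,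
      F (realizationPoint x t) = φ p x t := by
  let η : X ⟶ TopCat.toSSet.obj (TopCat.of Y) :=
    { app p := ↾fun x ↦ (TopCat.toSSetObjEquiv (TopCat.of Y) p).symm (φ p.unop x)
      naturality p q f := by
        ext x
        apply (TopCat.toSSetObjEquiv (TopCat.of Y) q).injective
        ext t
        exact hφ _ _ f.unop x t }
  obtain ⟨F, h1⟩ : ∃ F : SSet.toTop.obj X ⟶ TopCat.of Y,
      sSetTopAdj.unit.app X ≫ TopCat.toSSet.map F = η :=
    ⟨(sSetTopAdj.homEquiv _ _).symm η,
      (sSetTopAdj.homEquiv_unit _ _ _).symm.trans ((sSetTopAdj.homEquiv _ _).apply_symm_apply η)⟩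
  refine ⟨F.hom, fun p x t ↦ ?_⟩
  have h2 : φ p x = TopCat.toSSetObjEquiv (TopCat.of Y) (op p) (η.app (op p) x) := by
    exact ((TopCat.toSSetObjEquiv (TopCat.of Y) (op p)).apply_symm_apply _).symm
  rw [h2, ← h1]
  have h3 := sSetTopAdj_unit_app_app_down X (op p) x
  have h4 := ConcreteCategory.congr_hom h3 (ULift.up t)
  have h5 := congrArg F.hom h4
  exact h5.symm

end SSet

lemma stdSimplex.map_apply {ι κ : Type*} [Fintype ι] [Fintype κ] [DecidableEq κ] (f : ι → κ)
    (t : stdSimplex ℝ ι) (y : κ) :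
    stdSimplex.map f t y = ∑ i with f i = y, t i := by
  simp [FunOnFinite.linearMap_apply_apply]

lemma stdSimplex.map_apply_of_injective {ι κ : Type*} [Fintype ι] [Fintype κ] {f : ι → κ}
    (hf : Function.Injective f) (t : stdSimplex ℝ ι) (i : ι) :
    stdSimplex.map f t (f i) = t i := by
  classical
  simp only [stdSimplex.map_apply, hf.eq_iff]
  rw [Finset.sum_filter, Finset.sum_ite_eq' Finset.univ i]
  simp

lemma stdSimplex.map_apply_ne_zero_iff {ι κ : Type*} [Fintype ι] [Fintype κ] (f : ι → κ)
    (t : stdSimplex ℝ ι) (y : κ) :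
    stdSimplex.map f t y ≠ 0 ↔ ∃ i, f i = y ∧ t i ≠ 0 := by
  classical
  rw [stdSimplex.map_apply, Ne, Finset.sum_eq_zero_iff_of_nonneg (fun i _ ↦ stdSimplex.zero_le t i)]
  simp

/-- A point of a standard simplex is the image of a point with nonzero coordinates of the face
spanned by its support. -/
lemma stdSimplex.exists_map_orderEmbedding_eq {p : ℕ} (t : stdSimplex ℝ (Fin (p + 1))) :
    ∃ (q : ℕ) (f : Fin (q + 1) ↪o Fin (p + 1)) (s : stdSimplex ℝ (Fin (q + 1))),
      (∀ i, s i ≠ 0) ∧ stdSimplex.map f s = t := by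
  classical
  let T : Finset (Fin (p + 1)) := {i | t i ≠ 0}
  have hT : T.card ≠ 0 := by
    intro h
    have h0 : ∀ i, t i = 0 := by simpa [T, Finset.filter_eq_empty_iff] using h
    have := stdSimplex.sum_eq_one t
    simp [h0] at this
  obtain ⟨q, hq⟩ := Nat.exists_eq_succ_of_ne_zero hT
  let f := T.orderEmbOfFin hq
  have hrange : ∀ i, t i ≠ 0 ↔ ∃ j, f j = i := fun i ↦ by
    have : i ∈ Set.range f ↔ i ∈ (T : Set _) := by rw [Finset.range_orderEmbOfFin]
    simpa [T] using this.symm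
  have hsum : ∑ j, t (f j) = 1 := by
    rw [← stdSimplex.sum_eq_one t]
    refine Finset.sum_of_injOn f f.injective.injOn (by simp) (fun i _ hi ↦ ?_) (by simp)
    by_contra h
    obtain ⟨j, hj⟩ := (hrange i).1 h
    exact hi ⟨j, by simp, hj⟩
  refine ⟨q, f, ⟨fun j ↦ t (f j), fun j ↦ t.2.1 _, hsum⟩, fun i ↦ (hrange _).2 ⟨i, rfl⟩, ?_⟩
  ext i
  by_cases hi : t i = 0
  · rw [hi]
    by_contra h
    obtain ⟨j, rfl, hj⟩ := (stdSimplex.map_apply_ne_zero_iff _ _ _).1 h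
    exact hj hi
  · obtain ⟨j, rfl⟩ := (hrange i).1 hi
    exact stdSimplex.map_apply_of_injective f.injective _ j

namespace CategoryTheory.nerve

open SSet

variable {P : Type} [PartialOrder P]

/-- Every point of the realization of the nerve of a poset lies in the interior of
a strictly increasing chain. -/
lemma exists_strictMono_realizationPoint_eq (z : SSet.toTop.obj (nerve P)) :
    ∃ (p : ℕ) (x : (nerve P).obj (op ⦋p⦌)) (t : _root_.stdSimplex ℝ (Fin (p + 1))),
      StrictMono x.obj ∧ (∀ i, t i ≠ 0) ∧ realizationPoint x t = z := by
  obtain ⟨p, x, t, rfl⟩ := exists_realizationPoint_eq z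
  obtain ⟨q, f, s, hs, rfl⟩ := stdSimplex.exists_map_orderEmbedding_eq t
  let f' : ⦋q⦌ ⟶ p := SimplexCategory.Hom.mk f.toOrderHom
  have h1 := realizationPoint_map f' x s
  obtain ⟨m, g, hg, y, hy⟩ := (nerve P).exists_nonDegenerate ((nerve P).map f'.op x)
  have h2 := realizationPoint_map g y.1 s
  refine ⟨m, y.1, stdSimplex.map g s,
    (PartialOrder.mem_nerve_nonDegenerate_iff_strictMono _).1 y.2, fun i ↦ ?_, ?_⟩
  · obtain ⟨j, hj⟩ := SimplexCategory.epi_iff_surjective.1 hg i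
    exact (stdSimplex.map_apply_ne_zero_iff _ _ _).2 ⟨j, hj, hs j⟩
  · rw [← h2, ← hy]
    exact h1

variable [Fintype P]

lemma exists_weights :
    ∃ F : C(SSet.toTop.obj (nerve P), _root_.stdSimplex ℝ P),
      ∀ (p : SimplexCategory) (x : (nerve P).obj (op p)) t,
        F (realizationPoint x t) = stdSimplex.map x.obj t :=
  exists_realization_lift (X := nerve P)
    (fun _ x ↦ ⟨stdSimplex.map x.obj, stdSimplex.continuous_map _⟩)
    (fun _ _ f x t ↦ (stdSimplex.map_comp_apply f x.obj t).symm)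

/-- The barycentric coordinates of a point of the realization of the nerve of a finite poset. -/
noncomputable def weights : C(SSet.toTop.obj (nerve P), _root_.stdSimplex ℝ P) :=
  exists_weights.choose

lemma weights_realizationPoint {p : SimplexCategory} (x : (nerve P).obj (op p))
    (t : _root_.stdSimplex ℝ (Fin (p.len + 1))) :
    weights (realizationPoint x t) = stdSimplex.map x.obj t :=
  exists_weights.choose_spec p x t

lemma weights_injective : Function.Injective (weights (P := P)) := by
  intro z z' h
  obtain ⟨p, x, t, hx, ht, rfl⟩ := exists_strictMono_realizationPoint_eq z
  obtain ⟨p', x', t', hx', ht', rfl⟩ := exists_strictMono_realizationPoint_eq z'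
  rw [weights_realizationPoint, weights_realizationPoint] at h
  have key : ∀ {p : ℕ} (x : (nerve P).obj (op ⦋p⦌)) (t : _root_.stdSimplex ℝ (Fin (p + 1))),
      (∀ i, t i ≠ 0) → Set.range x.obj = {y | stdSimplex.map x.obj t y ≠ 0} := by
    intro p x t ht
    ext y
    simp only [Set.mem_range, Set.mem_ofPred_eq, stdSimplex.map_apply_ne_zero_iff]
    exact ⟨fun ⟨i, hi⟩ ↦ ⟨i, hi, ht i⟩, fun ⟨i, hi, _⟩ ↦ ⟨i, hi⟩⟩
  have hr : Set.range x.obj = Set.range x'.obj := by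
    rw [key x t ht, key x' t' ht', h]
  obtain rfl : p = p' := by
    have h1 := Set.ncard_range_of_injective hx.injective
    have h2 := Set.ncard_range_of_injective hx'.injective
    rw [hr, h2] at h1
    simpa using h1.symm
  obtain rfl : x = x' := nerve.ext_of_isThin ((hx.range_inj hx').1 hr)
  congr 1
  ext i
  rw [← stdSimplex.map_apply_of_injective hx.injective t i,
    ← stdSimplex.map_apply_of_injective hx.injective t' i, h]

lemma isChain_weights (z : SSet.toTop.obj (nerve P)) :
    IsChain (· ≤ ·) {y | weights z y ≠ 0} := by
  obtain ⟨p, x, t, rfl⟩ := exists_realizationPoint_eq z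
  rw [weights_realizationPoint]
  intro a ha b hb _
  obtain ⟨i, rfl, -⟩ := (stdSimplex.map_apply_ne_zero_iff _ _ _).1 ha
  obtain ⟨j, rfl, -⟩ := (stdSimplex.map_apply_ne_zero_iff _ _ _).1 hb
  exact (le_total i j).imp (fun h ↦ x.monotone h) (fun h ↦ x.monotone h)

lemma exists_weights_eq (w : _root_.stdSimplex ℝ P) (hw : IsChain (· ≤ ·) {y | w y ≠ 0}) :
    ∃ z, weights z = w := by
  classical
  let S : Type := {y // w y ≠ 0}
  let _ : LinearOrder S :=
    { (inferInstance : PartialOrder S) with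
      le_total := fun a b ↦ hw.total a.2 b.2
      toDecidableLE := Classical.decRel _ }
  have hS : Fintype.card S ≠ 0 := by
    intro h
    rw [Fintype.card_eq_zero_iff] at h
    have h0 : ∀ y, w y = 0 := fun y ↦ by_contra fun hy ↦ h.elim ⟨y, hy⟩
    have := stdSimplex.sum_eq_one w
    simp [h0] at this
  obtain ⟨p, hp⟩ := Nat.exists_eq_succ_of_ne_zero hS
  let e : Fin (p + 1) ≃o S := Fintype.orderIsoFinOfCardEq S hp
  let c : Fin (p + 1) → P := fun i ↦ (e i).1
  have hc : Monotone c := fun i j h ↦ e.monotone h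
  have hci : Function.Injective c := Subtype.val_injective.comp e.injective
  have hcr : ∀ y, w y ≠ 0 → ∃ i, c i = y := fun y hy ↦ ⟨e.symm ⟨y, hy⟩, by simp [c]⟩
  let x : (nerve P).obj (op ⦋p⦌) := hc.functor
  have hsum : ∑ i, w (c i) = 1 := by
    rw [← stdSimplex.sum_eq_one w]
    refine Finset.sum_of_injOn c hci.injOn (by simp) (fun y _ hy ↦ ?_) (by simp)
    by_contra h
    obtain ⟨j, hj⟩ := hcr y h
    exact hy ⟨j, by simp, hj⟩
  refine ⟨realizationPoint x ⟨fun i ↦ w (c i), fun i ↦ w.2.1 _, hsum⟩, ?_⟩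
  rw [weights_realizationPoint]
  ext y
  by_cases hy : w y = 0
  · rw [hy]
    by_contra h
    obtain ⟨j, rfl, hj⟩ := (stdSimplex.map_apply_ne_zero_iff _ _ _).1 h
    exact hj hy
  · obtain ⟨i, rfl⟩ := hcr y hy
    exact stdSimplex.map_apply_of_injective hci _ i

instance compactSpace_realization : CompactSpace (SSet.toTop.obj (nerve P)) := by
  have hfin : ∀ p : ℕ, Finite ((nerve P).obj (op ⦋p⦌)) := fun p ↦
    Finite.of_injective (fun x : (nerve P).obj (op ⦋p⦌) ↦ (x.obj : Fin (p + 1) → P))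
      fun x y h ↦ nerve.ext_of_isThin h
  have hu : (Set.univ : Set (SSet.toTop.obj (nerve P))) =
      ⋃ (p : Fin (Fintype.card P)) (x : (nerve P).obj (op ⦋p⦌)),
        Set.range (realizationPoint x) := by
    refine (Set.eq_univ_of_forall fun z ↦ ?_).symm
    obtain ⟨p, x, t, hx, -, rfl⟩ := exists_strictMono_realizationPoint_eq z
    have hp : p < Fintype.card P := by
      simpa using Fintype.card_le_of_injective _ hx.injective
    exact Set.mem_iUnion₂.2 ⟨⟨p, hp⟩, x, ⟨t, rfl⟩⟩
  refine ⟨hu ▸ isCompact_iUnion fun p ↦ ?_⟩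
  have := hfin p
  exact isCompact_iUnion fun x ↦ isCompact_range (continuous_realizationPoint x)

end CategoryTheory.nerve

lemma Convex.nonempty_homeomorph_closedBall {F : Type*} [NormedAddCommGroup F] [NormedSpace ℝ F]
    [FiniteDimensional ℝ F] {d : ℕ} (hd : Module.finrank ℝ F = d) {K : Set F} (hK : Convex ℝ K)
    (hKc : IsCompact K) (hKi : (interior K).Nonempty) :
    Nonempty (K ≃ₜ Metric.closedBall (0 : EuclideanSpace ℝ (Fin d)) 1) := by
  let L : F ≃L[ℝ] EuclideanSpace ℝ (Fin d) := ContinuousLinearEquiv.ofFinrankEq (by simp [hd])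
  have hLc : IsCompact (L '' K) := hKc.image L.continuous
  obtain ⟨h, -, hh, -⟩ := exists_homeomorph_image_interior_closure_frontier_eq_unitBall
    (hK.linear_image L.toLinearMap)
    (by
      change (interior (L.toHomeomorph '' K)).Nonempty
      rw [← Homeomorph.image_interior]
      exact hKi.image _) hLc.isBounded
  have hh' : h '' (L '' K) = Metric.closedBall 0 1 := by
    rw [← hh]
    exact congrArg _ hLc.isClosed.closure_eq.symm
  exact ⟨(L.toHomeomorph.image K).trans ((h.image _).trans (Homeomorph.setCongr hh'))⟩

/-- Families of antitone functions `Fin N → [0, 1]`: a product of `m` ordered simplices. -/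
def antitoneFamilies (m N : ℕ) : Set (Fin m × Fin N → ℝ) :=
  {U | (∀ j, U j ∈ Set.Icc 0 1) ∧ ∀ i, Antitone fun c ↦ U (i, c)}

lemma convex_antitoneFamilies (m N : ℕ) : Convex ℝ (antitoneFamilies m N) := by
  intro U hU V hV a b ha hb hab
  refine ⟨fun j ↦ convex_Icc 0 1 (hU.1 j) (hV.1 j) ha hb hab, fun i c c' h ↦ ?_⟩
  have h1 := hU.2 i h
  have h2 := hV.2 i h
  simp only [Pi.add_apply, Pi.smul_apply, smul_eq_mul] at *
  gcongr

lemma isCompact_antitoneFamilies (m N : ℕ) : IsCompact (antitoneFamilies m N) := by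
  refine (isCompact_univ_pi (s := fun _ : Fin m × Fin N ↦ Set.Icc (0 : ℝ) 1)
    fun _ ↦ isCompact_Icc).of_isClosed_subset ?_ fun U hU j _ ↦ hU.1 j
  have : antitoneFamilies m N = (⋂ j, {U | U j ∈ Set.Icc (0 : ℝ) 1}) ∩
      ⋂ (i) (c) (c') (_ : c ≤ c'), {U | U (i, c') ≤ U (i, c)} := by
    ext U
    simp [antitoneFamilies, Antitone]
  rw [this]
  refine (isClosed_iInter fun j ↦ isClosed_Icc.preimage (continuous_apply j)).inter ?_
  exact isClosed_iInter fun i ↦ isClosed_iInter fun c ↦ isClosed_iInter fun c' ↦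
    isClosed_iInter fun _ ↦ isClosed_le (continuous_apply _) (continuous_apply _)

lemma interior_antitoneFamilies_nonempty (m N : ℕ) :
    (interior (antitoneFamilies m N)).Nonempty := by
  let s : Set (Fin m × Fin N → ℝ) := (⋂ j, {U | U j ∈ Set.Ioo (0 : ℝ) 1}) ∩
      ⋂ (i) (c) (c') (_ : c < c'), {U | U (i, c') < U (i, c)}
  have hs : IsOpen s := by
    refine (isOpen_iInter_of_finite fun j ↦ isOpen_Ioo.preimage (continuous_apply j)).inter ?_
    exact isOpen_iInter_of_finite fun i ↦ isOpen_iInter_of_finite fun c ↦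
      isOpen_iInter_of_finite fun c' ↦ isOpen_iInter_of_finite fun _ ↦
        isOpen_lt (continuous_apply _) (continuous_apply _)
  have hsK : s ⊆ antitoneFamilies m N := by
    intro U hU
    simp only [s, Set.mem_inter_iff, Set.mem_iInter] at hU
    refine ⟨fun j ↦ Set.Ioo_subset_Icc_self (hU.1 j), fun i ↦ ?_⟩
    exact StrictAnti.antitone fun c c' h ↦ hU.2 i c c' h
  refine ⟨fun j ↦ 1 / ((j.2.1 : ℝ) + 2), interior_maximal hsK hs ?_⟩
  simp only [s, Set.mem_inter_iff, Set.mem_iInter]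
  refine ⟨fun j ↦ ⟨by positivity, ?_⟩, fun i c c' h ↦ ?_⟩
  · rw [div_lt_one (by positivity)]
    linarith [(Nat.cast_nonneg j.2.1 : (0 : ℝ) ≤ _)]
  · have : (c.1 : ℝ) < c'.1 := by exact_mod_cast h
    change (1 : ℝ) / ((c'.1 : ℝ) + 2) < 1 / ((c.1 : ℝ) + 2)
    exact one_div_lt_one_div_of_lt (by positivity) (add_lt_add_left this 2)

section ProductOfChains

variable {m N : ℕ}

/-- The tail sums `∑ w q`, over the `q` whose `i`-th coordinate exceeds `c`. -/
def tails (w : (Fin m → Fin (N + 1)) → ℝ) : Fin m × Fin N → ℝ :=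
  fun j ↦ ∑ q with j.2.castSucc < q j.1, w q

lemma continuous_tails : Continuous (tails (m := m) (N := N)) := by
  unfold tails
  fun_prop

lemma tails_mem (w : stdSimplex ℝ (Fin m → Fin (N + 1))) : tails w ∈ antitoneFamilies m N := by
  refine ⟨fun j ↦ ⟨Finset.sum_nonneg fun q _ ↦ stdSimplex.zero_le w q, ?_⟩, fun i c c' h ↦ ?_⟩
  · rw [← stdSimplex.sum_eq_one w]
    exact Finset.sum_le_univ_sum_of_nonneg (stdSimplex.zero_le w)
  · refine Finset.sum_le_sum_of_subset_of_nonneg (fun q hq ↦ ?_) fun q _ _ ↦ stdSimplex.zero_le w q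
    simp only [Finset.mem_filter, Finset.mem_univ, true_and] at hq ⊢
    exact lt_of_le_of_lt (Fin.castSucc_le_castSucc_iff.2 h) hq

lemma sum_le_apply_eq_of_tails_eq {w w' : stdSimplex ℝ (Fin m → Fin (N + 1))}
    (h : tails w = tails w') (i : Fin m) (c : Fin (N + 1)) :
    ∑ y with c ≤ y i, w y = ∑ y with c ≤ y i, w' y := by
  induction c using Fin.cases with
  | zero => simp
  | succ c =>
    have := congrFun h (i, c)
    simpa only [tails, Fin.castSucc_lt_iff_succ_le] using this

open scoped Classical in
/-- For weights supported on a chain, the mass above `q` is the least of the masses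
above its coordinates. -/
lemma exists_sum_ge_eq (w : stdSimplex ℝ (Fin m → Fin (N + 1)))
    (hw : IsChain (· ≤ ·) {y | w y ≠ 0}) (q : Fin m → Fin (N + 1)) :
    ∑ y with q ≤ y, w y = 1 ∨ ∃ i, ∑ y with q ≤ y, w y = ∑ y with q i ≤ y i, w y := by
  let A : Finset (Fin m → Fin (N + 1)) := {y | w y ≠ 0 ∧ ¬ q ≤ y}
  rcases A.eq_empty_or_nonempty with hA | hA
  · left
    rw [← stdSimplex.sum_eq_one w]
    refine Finset.sum_filter_of_ne fun y _ hy ↦ ?_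
    by_contra hqy
    exact Finset.notMem_empty y (hA ▸ (by simp [A, hy, hqy] : y ∈ A))
  · right
    obtain ⟨y₀, hy₀⟩ := A.exists_maximal hA
    have hmem : ∀ y, y ∈ A ↔ w y ≠ 0 ∧ ¬ q ≤ y := fun y ↦ by simp [A]
    have hy₀A := (hmem y₀).1 hy₀.1
    obtain ⟨i, hi⟩ : ∃ i, ¬ q i ≤ y₀ i := by simpa [Pi.le_def] using hy₀A.2
    refine ⟨i, Finset.sum_subset_zero_on_sdiff (fun y hy ↦ ?_) (fun y hy ↦ ?_) fun _ _ ↦ rfl⟩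
    · simp only [Finset.mem_filter, Finset.mem_univ, true_and] at hy ⊢
      exact hy i
    · simp only [Finset.mem_sdiff, Finset.mem_filter, Finset.mem_univ, true_and] at hy
      by_contra hwy
      have hyA : y ∈ A := (hmem y).2 ⟨hwy, hy.2⟩
      have hle : y ≤ y₀ := (hw.total hwy hy₀A.1).elim id fun h ↦ hy₀.2 hyA h
      exact hi (hy.1.trans (hle i))

open scoped Classical in
lemma sum_ge_le_of_tails_eq {w w' : stdSimplex ℝ (Fin m → Fin (N + 1))}
    (hw : IsChain (· ≤ ·) {y | w y ≠ 0}) (h : tails w = tails w') (q : Fin m → Fin (N + 1)) :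
    ∑ y with q ≤ y, w' y ≤ ∑ y with q ≤ y, w y := by
  rcases exists_sum_ge_eq w hw q with h1 | ⟨i, h1⟩
  · rw [h1, ← stdSimplex.sum_eq_one w']
    exact Finset.sum_le_univ_sum_of_nonneg (stdSimplex.zero_le w')
  · rw [h1, sum_le_apply_eq_of_tails_eq h]
    refine Finset.sum_le_sum_of_subset_of_nonneg (fun y hy ↦ ?_) fun y _ _ ↦ stdSimplex.zero_le w' y
    simp only [Finset.mem_filter, Finset.mem_univ, true_and] at hy ⊢
    exact hy i

open scoped Classical in
lemma eq_of_sum_ge_eq {P : Type*} [PartialOrder P] [Fintype P] {w w' : P → ℝ}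
    (h : ∀ q, ∑ y with q ≤ y, w y = ∑ y with q ≤ y, w' y) : w = w' := by
  funext q
  induction q using WellFoundedGT.induction with
  | ind q ih =>
    have hq := h q
    rw [← Finset.add_sum_erase _ w (a := q) (by simp),
      ← Finset.add_sum_erase _ w' (a := q) (by simp)] at hq
    rw [Finset.sum_congr rfl fun y hy ↦ ?_] at hq
    · exact add_right_cancel hq
    · simp only [Finset.mem_erase, Finset.mem_filter, Finset.mem_univ, true_and] at hy
      exact ih y (lt_of_le_of_ne hy.2 hy.1.symm)

open scoped Classical in
lemma eq_of_tails_eq {w w' : stdSimplex ℝ (Fin m → Fin (N + 1))}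
    (hw : IsChain (· ≤ ·) {y | w y ≠ 0}) (hw' : IsChain (· ≤ ·) {y | w' y ≠ 0})
    (h : tails w = tails w') : w = w' :=
  stdSimplex.ext (eq_of_sum_ge_eq fun q ↦
    (sum_ge_le_of_tails_eq hw' h.symm q).antisymm (sum_ge_le_of_tails_eq hw h q))

/-- The quantile function of the family of tails `U`. -/
noncomputable def quantile (U : Fin m × Fin N → ℝ) (t : ℝ) : Fin m → Fin (N + 1) :=
  fun i ↦ ⟨(Finset.univ.filter fun c : Fin N ↦ t ≤ U (i, c)).card,
    Nat.lt_succ_of_le ((Finset.card_le_univ _).trans (by simp))⟩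

lemma antitone_quantile (U : Fin m × Fin N → ℝ) : Antitone (quantile U) := fun _ _ h _ ↦
  Fin.mk_le_mk.2 (Finset.card_le_card fun _ hc ↦ by
    simp only [Finset.mem_filter, Finset.mem_univ, true_and] at hc ⊢
    exact h.trans hc)

lemma castSucc_lt_quantile_iff {U : Fin m × Fin N → ℝ} (hU : U ∈ antitoneFamilies m N)
    (t : ℝ) (i : Fin m) (c : Fin N) : c.castSucc < quantile U t i ↔ t ≤ U (i, c) := by
  rw [Fin.lt_def]
  change c.1 < (Finset.univ.filter fun c : Fin N ↦ t ≤ U (i, c)).card ↔ _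
  constructor
  · intro h
    by_contra ht
    refine absurd (Finset.card_le_card (t := Finset.Iio c) fun c' hc' ↦ ?_) (by simpa using h)
    simp only [Finset.mem_filter, Finset.mem_univ, true_and, Finset.mem_Iio] at hc' ⊢
    by_contra hcc
    exact ht (hc'.trans (hU.2 i (not_lt.1 hcc)))
  · intro h
    have := Finset.card_le_card (s := Finset.Iic c)
      (t := Finset.univ.filter fun c : Fin N ↦ t ≤ U (i, c)) fun c' hc' ↦ by
        simp only [Finset.mem_filter, Finset.mem_univ, true_and, Finset.mem_Iic] at hc' ⊢
        exact h.trans (hU.2 i hc')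
    simpa using this

open MeasureTheory in
lemma exists_tails_eq {U : Fin m × Fin N → ℝ} (hU : U ∈ antitoneFamilies m N) :
    ∃ w : stdSimplex ℝ (Fin m → Fin (N + 1)),
      IsChain (· ≤ ·) {y | w y ≠ 0} ∧ tails w = U := by
  let μ : Measure ℝ := volume.restrict (Set.Ioc 0 1)
  have hμ : IsProbabilityMeasure μ := ⟨by simp [μ]⟩
  have hmeas : ∀ q, MeasurableSet (quantile U ⁻¹' {q}) := fun q ↦
    ((Set.ordConnected_singleton (a := q)).preimage_anti (antitone_quantile U)).measurableSet
  have hsum : ∀ s : Finset (Fin m → Fin (N + 1)),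
      ∑ q ∈ s, μ.real (quantile U ⁻¹' {q}) = μ.real (quantile U ⁻¹' s) := fun s ↦
    sum_measureReal_preimage_singleton s fun q _ ↦ hmeas q
  refine ⟨⟨fun q ↦ μ.real (quantile U ⁻¹' {q}), fun q ↦ measureReal_nonneg, ?_⟩, ?_, ?_⟩
  · rw [hsum]
    simp
  · intro a ha b hb _
    obtain ⟨s, hs⟩ := nonempty_of_measureReal_ne_zero ha
    obtain ⟨t, ht⟩ := nonempty_of_measureReal_ne_zero hb
    rw [← show quantile U s = a from hs, ← show quantile U t = b from ht]
    exact (le_total t s).imp (fun h ↦ antitone_quantile U h) (fun h ↦ antitone_quantile U h)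
  · funext ⟨i, c⟩
    refine (hsum _).trans ?_
    have hset : quantile U ⁻¹' ↑(Finset.univ.filter fun q : Fin m → Fin (N + 1) ↦
        c.castSucc < q i) = Set.Iic (U (i, c)) := by
      ext t
      simp [castSucc_lt_quantile_iff hU]
    have hb := hU.1 (i, c)
    rw [hset, measureReal_restrict_apply measurableSet_Iic, Set.inter_comm,
      Set.Ioc_inter_Iic, min_eq_right hb.2, Real.volume_real_Ioc_of_le hb.1, sub_zero]

/-- The realization of the nerve of a product of chains is a product of simplices. -/
lemma nonempty_homeomorph_antitoneFamilies {P : Type} [PartialOrder P]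
    (e : P ≃o (Fin m → Fin (N + 1))) :
    Nonempty (SSet.toTop.obj (nerve P) ≃ₜ antitoneFamilies m N) := by
  let _ : Fintype P := Fintype.ofEquiv _ e.symm.toEquiv
  have hchain : ∀ {Q R : Type} [PartialOrder Q] [PartialOrder R] [Fintype Q] [Fintype R]
      (f : Q ≃o R) (w : stdSimplex ℝ Q), IsChain (· ≤ ·) {y | w y ≠ 0} →
      IsChain (· ≤ ·) {y | stdSimplex.map f w y ≠ 0} := by
    intro Q R _ _ _ _ f w hw a ha b hb _
    obtain ⟨a, rfl, ha'⟩ := (stdSimplex.map_apply_ne_zero_iff _ _ _).1 ha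
    obtain ⟨b, rfl, hb'⟩ := (stdSimplex.map_apply_ne_zero_iff _ _ _).1 hb
    exact (hw.total ha' hb').imp (fun h ↦ f.monotone h) (fun h ↦ f.monotone h)
  let Φ : SSet.toTop.obj (nerve P) → antitoneFamilies m N :=
    fun z ↦ ⟨tails (stdSimplex.map e (nerve.weights z)), tails_mem _⟩
  have hΦ : Function.Bijective Φ := by
    refine ⟨fun z z' h ↦ nerve.weights_injective ?_, fun ⟨U, hU⟩ ↦ ?_⟩
    · have := eq_of_tails_eq (hchain e _ (nerve.isChain_weights z))
        (hchain e _ (nerve.isChain_weights z')) (congrArg Subtype.val h)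
      ext y
      rw [← stdSimplex.map_apply_of_injective e.injective, this,
        stdSimplex.map_apply_of_injective e.injective]
    · obtain ⟨w, hw, rfl⟩ := exists_tails_eq hU
      obtain ⟨z, hz⟩ := nerve.exists_weights_eq _ (hchain e.symm w hw)
      refine ⟨z, Subtype.ext ?_⟩
      change tails (stdSimplex.map e (nerve.weights z)) = tails w
      rw [hz, stdSimplex.map_comp_apply, show e ∘ e.symm = id from funext e.apply_symm_apply,
        stdSimplex.map_id_apply]
  have hc : Continuous Φ := Continuous.subtype_mk (continuous_tails.comp
    (continuous_subtype_val.comp ((stdSimplex.continuous_map e).comp nerve.weights.continuous))) _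
  exact ⟨Continuous.homeoOfEquivCompactToT2 (f := Equiv.ofBijective Φ hΦ) hc⟩

end ProductOfChains

section LevelFunctions

variable {n k : ℕ}

namespace Realizes

variable {g : ℕ → Fin k → ℕ} {d : Fin k → Fin k → ℕ}

lemma eq_or_exists (h : Realizes n k g d) {a b : Fin k} (hab : a < b) :
    ((∀ j, 1 ≤ j → j < n → g j a = g j b) ∧ d a b = n) ∨
      (1 ≤ d a b ∧ d a b < n ∧ (∀ j, 1 ≤ j → j < d a b → g j a = g j b) ∧
        g (d a b) a < g (d a b) b) := by
  classical
  by_cases hall : ∀ j, 1 ≤ j → j < n → g j a = g j b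
  · exact Or.inl ⟨hall, (h a b hab).1 hall⟩
  · right
    have hex : ∃ j, 1 ≤ j ∧ j < n ∧ g j a ≠ g j b := by simpa using hall
    obtain ⟨h1, hn, hne⟩ := Nat.find_spec hex
    have hmin : ∀ j, 1 ≤ j → j < Nat.find hex → g j a = g j b := fun j hj hlt ↦ by
      by_contra hgj
      exact Nat.find_min hex hlt ⟨hj, hlt.trans hn, hgj⟩
    obtain ⟨hd, hlt⟩ := (h a b hab).2 _ h1 hn hne hmin
    rw [hd]
    exact ⟨h1, hn, hmin, hlt⟩

lemma le_iff (h : Realizes n k g d) {a b : Fin k} (hab : a < b) {j : ℕ} (hj : j ≤ n) :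
    j ≤ d a b ↔ ∀ i, 1 ≤ i → i < j → g i a = g i b := by
  rcases h.eq_or_exists hab with ⟨h1, h2⟩ | ⟨h1, h2, h3, h4⟩
  · exact ⟨fun _ i hi hij ↦ h1 i hi (hij.trans_le hj), fun _ ↦ h2 ▸ hj⟩
  · refine ⟨fun hjd i hi hij ↦ h3 i hi (hij.trans_le hjd), fun H ↦ ?_⟩
    by_contra hlt
    exact h4.ne (H _ h1 (not_le.1 hlt))

lemma le_of_le (h : Realizes n k g d) {a b c : Fin k} (hab : a < b) (hbc : b < c) :
    d a c ≤ d a b := by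
  by_contra! hlt
  rcases h.eq_or_exists hab with ⟨h1, h2⟩ | ⟨h1, h2, h3, h4⟩
  · rcases h.eq_or_exists (hab.trans hbc) with ⟨-, h2'⟩ | ⟨-, h2', -⟩ <;> omega
  · have hac : d a c ≤ n := by
      rcases h.eq_or_exists (hab.trans hbc) with ⟨-, h2'⟩ | ⟨-, h2', -⟩ <;> omega
    have heq := (h.le_iff (hab.trans hbc) hac).1 le_rfl
    have hbc' : d a b ≤ d b c := (h.le_iff hbc h2.le).2 fun i hi hij ↦
      (h3 i hi hij).symm.trans (heq i hi (hij.trans hlt))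
    have hle : g (d a b) b ≤ g (d a b) c := by
      rcases hbc'.lt_or_eq with hlt' | heq'
      · rcases h.eq_or_exists hbc with ⟨h1', -⟩ | ⟨-, -, h3', -⟩
        · exact (h1' _ h1 h2).le
        · exact (h3' _ h1 hlt').le
      · rcases h.eq_or_exists hbc with ⟨-, h2'⟩ | ⟨-, -, -, h4'⟩
        · omega
        · exact heq' ▸ h4'.le
    have := heq _ h1 hlt
    omega

lemma eq_min (h : Realizes n k g d) {a b c : Fin k} (hab : a < b) (hbc : b < c) :
    d a c = min (d a b) (d b c) := by
  have hle : ∀ {a b : Fin k}, a < b → d a b ≤ n := fun hab ↦ by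
    rcases h.eq_or_exists hab with ⟨-, h2⟩ | ⟨-, h2, -⟩ <;> omega
  have hac := hab.trans hbc
  have h1 := h.le_of_le hab hbc
  apply le_antisymm
  · refine le_min h1 ((h.le_iff hbc (hle hac)).2 fun i hi hij ↦ ?_)
    exact ((h.le_iff hab (hle hac)).1 h1 i hi hij).symm.trans
      ((h.le_iff hac (hle hac)).1 le_rfl i hi hij)
  · have hm : min (d a b) (d b c) ≤ n := (min_le_left _ _).trans (hle hab)
    refine (h.le_iff hac hm).2 fun i hi hij ↦ ?_
    exact ((h.le_iff hab hm).1 (min_le_left _ _) i hi hij).trans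
      ((h.le_iff hbc hm).1 (min_le_right _ _) i hi hij)

end Realizes

namespace LFun

variable {N m : ℕ}

/-- The levels of consecutive elements, shifted to start at `0`. -/
def gaps (x : LFun (N + 1) (m + 1)) (i : Fin m) : Fin (N + 1) :=
  ⟨x.d i.castSucc i.succ - 1, by
    have := x.bounds i.castSucc i.succ Fin.castSucc_lt_succ
    omega⟩

lemma d_castSucc_succ (x : LFun (N + 1) (m + 1)) (i : Fin m) :
    x.d i.castSucc i.succ = x.gaps i + 1 := by
  have := x.bounds i.castSucc i.succ Fin.castSucc_lt_succ
  simp only [gaps]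
  omega

lemma gaps_le_gaps_iff {x y : LFun (N + 1) (m + 1)} : x.gaps ≤ y.gaps ↔ x ≤ y := by
  constructor
  · intro h a b
    induction b using Fin.induction with
    | zero => rw [x.zero _ _ (by simp)]; exact Nat.zero_le _
    | succ i ih =>
      have hi : x.d i.castSucc i.succ ≤ y.d i.castSucc i.succ := by
        rw [d_castSucc_succ, d_castSucc_succ]
        exact Nat.succ_le_succ (h i)
      rcases lt_trichotomy a i.castSucc with hlt | rfl | hgt
      · obtain ⟨gx, hx⟩ := x.realizable
        obtain ⟨gy, hy⟩ := y.realizable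
        rw [hx.eq_min hlt Fin.castSucc_lt_succ, hy.eq_min hlt Fin.castSucc_lt_succ]
        exact min_le_min ih hi
      · exact hi
      · rw [x.zero _ _ (not_lt.2 (Fin.castSucc_lt_iff_succ_le.1 hgt))]
        exact Nat.zero_le _
  · intro h i
    have := h i.castSucc i.succ
    rw [d_castSucc_succ, d_castSucc_succ] at this
    exact Nat.le_of_succ_le_succ this

lemma gaps_surjective : Function.Surjective (gaps (N := N) (m := m)) := by
  intro f
  let S : Fin (m + 1) → Fin (m + 1) → Finset (Fin m) := fun a b ↦
    {i | a ≤ i.castSucc ∧ i.castSucc < b}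
  let d : Fin (m + 1) → Fin (m + 1) → ℕ := fun a b ↦
    if a < b then ((S a b).inf f : Fin (N + 1)) + 1 else 0
  let g : ℕ → Fin (m + 1) → ℕ := fun j a ↦
    (Finset.univ.filter fun i : Fin m ↦ i.castSucc < a ∧ (f i : ℕ) < j).card
  have hg : ∀ j {a b : Fin (m + 1)}, a < b →
      g j b = g j a + ((S a b).filter fun i ↦ (f i : ℕ) < j).card := by
    intro j a b hab
    simp only [g]
    rw [← Finset.card_union_of_disjoint]
    · refine congrArg Finset.card ?_
      ext i
      simp only [S, Finset.mem_filter, Finset.mem_union, Finset.mem_univ, true_and]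
      constructor
      · rintro ⟨h1, h2⟩
        rcases lt_or_ge i.castSucc a with h | h
        · exact Or.inl ⟨h, h2⟩
        · exact Or.inr ⟨⟨h, h1⟩, h2⟩
      · rintro (⟨h1, h2⟩ | ⟨⟨-, h1⟩, h2⟩)
        · exact ⟨h1.trans hab, h2⟩
        · exact ⟨h1, h2⟩
    · rw [Finset.disjoint_left]
      intro i hi hi'
      simp only [S, Finset.mem_filter, Finset.mem_univ, true_and] at hi hi'
      exact absurd hi.1 (not_lt.2 hi'.1.1)
  have hS : ∀ {a b : Fin (m + 1)}, a < b → ((S a b).Nonempty) := by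
    intro a b hab
    refine ⟨⟨a, by omega⟩, ?_⟩
    simp only [S, Finset.mem_filter, Finset.mem_univ, true_and]
    exact ⟨le_rfl, hab⟩
  have hd : ∀ {a b : Fin (m + 1)}, a < b → ∃ i ∈ S a b, d a b = f i + 1 ∧
      ∀ i' ∈ S a b, f i ≤ f i' := by
    intro a b hab
    obtain ⟨i, hi, hmin⟩ := (S a b).exists_min_image f (hS hab)
    refine ⟨i, hi, ?_, hmin⟩
    simp only [d, if_pos hab]
    rw [le_antisymm (Finset.inf_le hi) (Finset.le_inf hmin)]
  refine ⟨⟨d, fun a b hab ↦ if_neg hab, fun a b hab ↦ ?_, g, fun a b hab ↦ ?_⟩, ?_⟩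
  · obtain ⟨i, -, hi, -⟩ := hd hab
    omega
  · obtain ⟨i, hi, hdi, hmin⟩ := hd hab
    have hgt : ∀ j, (f i : ℕ) < j → g j a < g j b := fun j hj ↦ by
      rw [hg j hab]
      exact Nat.lt_add_of_pos_right (Finset.card_pos.2 ⟨i, Finset.mem_filter.2 ⟨hi, hj⟩⟩)
    have hge : ∀ j, j ≤ (f i : ℕ) → g j a = g j b := fun j hj ↦ by
      rw [hg j hab, Finset.card_eq_zero.2, add_zero]
      exact Finset.filter_eq_empty_iff.2 fun i' hi' ↦ not_lt.2 (hj.trans (hmin i' hi'))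
    have hfi := (f i).2
    refine ⟨fun h ↦ ?_, fun j hj hjn hne hlt ↦ ?_⟩
    · by_contra hne
      exact (hgt (f i + 1) (by omega)).ne (h _ (by omega) (by omega))
    · have hij : (f i : ℕ) < j := by
        by_contra hle
        exact hne (hge j (not_lt.1 hle))
      refine ⟨?_, hgt j hij⟩
      by_contra hne'
      exact (hgt (f i + 1) (by omega)).ne (hlt _ (by omega) (by omega))
  · funext i
    obtain ⟨i', hi', hdi, -⟩ := hd (Fin.castSucc_lt_succ (i := i))
    have hii : i' = i := by
      simp only [S, Finset.mem_filter, Finset.mem_univ, true_and, Fin.le_def, Fin.lt_def] at hi'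
      simp only [Fin.val_castSucc, Fin.val_succ] at hi'
      omega
    subst hii
    apply Fin.ext
    simp only [gaps]
    omega

/-- A realizable level function is determined by its levels on consecutive elements, so that
`LFun n k` is a product of chains. -/
noncomputable def orderIso (N m : ℕ) : LFun (N + 1) (m + 1) ≃o (Fin m → Fin (N + 1)) :=
  RelIso.ofSurjective (OrderEmbedding.ofMapLEIff gaps fun _ _ ↦ gaps_le_gaps_iff) gaps_surjective

end LFun

end LevelFunctions

/-- STATEMENT 18: the geometric realization of the nerve of the poset `L_n(k)`
(the poset `S(1□ₙ2□ₙ⋯□ₙk)` underlying the Milgram preoperad) is homeomorphic to a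
closed disk of dimension `(n−1)(k−1)`. -/
theorem milgram_poset_nerve_homeo_disk (n k : ℕ) (hn : 1 ≤ n) (hk : 1 ≤ k) :
    Nonempty ((SSet.toTop.obj (nerve (LFun n k))) ≃ₜ
      (Metric.closedBall (0 : EuclideanSpace ℝ (Fin ((n - 1) * (k - 1)))) 1)) := by
  obtain ⟨N, rfl⟩ := Nat.exists_eq_succ_of_ne_zero (Nat.one_le_iff_ne_zero.1 hn)
  obtain ⟨m, rfl⟩ := Nat.exists_eq_succ_of_ne_zero (Nat.one_le_iff_ne_zero.1 hk)
  obtain ⟨e⟩ := nonempty_homeomorph_antitoneFamilies (LFun.orderIso N m)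
  obtain ⟨e'⟩ := (convex_antitoneFamilies m N).nonempty_homeomorph_closedBall
    (d := (N + 1 - 1) * (m + 1 - 1)) (by simp [mul_comm]) (isCompact_antitoneFamilies m N)
    (interior_antitoneFamilies_nonempty m N)
  exact ⟨e.trans e'⟩
end
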